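/- arXiv:0910.1176 — 3 statements merged into one kernel-verified Lean document; each statement's English description precedes it below -/
import Mathlib

section
/- Let U ⊆ ℂ^m and G ⊆ ℂ^n be nonempty open connected sets, and let V ⊆ U be a nonempty open set. Let f : U × G → ℂ be a function such that for every w ∈ G the map U ∋ z ↦ f(z,w) is holomorphic on U, and for every z ∈ V the map G ∋ w ↦ f(z,w) is holomorphic on G. Then f is holomorphic on U × G. -/
open Metric Set Filter Topology MeasureTheory

section PartialDerivatives

variable {E F : Type*} [NormedAddCommGroup E] [NormedSpace ℂ E]
  [NormedAddCommGroup F] [NormedSpace ℂ F]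

/-- Cauchy's estimate for the Fréchet derivative of a bounded holomorphic function. -/
theorem norm_fderiv_le_of_norm_le_on_ball {f : E → ℂ} {c : E} {r M : ℝ} (hr : 0 < r)
    (hf : DifferentiableOn ℂ f (ball c r)) (hM : ∀ x ∈ ball c r, ‖f x‖ ≤ M) :
    ‖fderiv ℂ f c‖ ≤ 2 * M / r := by
  refine Complex.norm_fderiv_le_div_of_mapsTo_ball hf (fun x hx => ?_) hr
  rw [mem_closedBall, dist_eq_norm]
  linarith [norm_sub_le (f x) (f c), hM x hx, hM c (mem_ball_self hr)]

/-- A bounded holomorphic function on a ball is Lipschitz at the center. -/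
theorem norm_sub_le_of_norm_le_on_ball {f : E → ℂ} {c z : E} {r M : ℝ}
    (hf : DifferentiableOn ℂ f (ball c r)) (hM : ∀ x ∈ ball c r, ‖f x‖ ≤ M)
    (hz : z ∈ ball c r) : ‖f z - f c‖ ≤ 2 * M / r * ‖z - c‖ := by
  rw [← dist_eq_norm, ← dist_eq_norm]
  refine Complex.dist_le_div_mul_dist_of_mapsTo_ball hf (fun x hx => ?_) hz
  rw [mem_closedBall, dist_eq_norm]
  linarith [norm_sub_le (f x) (f c), hM x hx, hM c (mem_ball_self (pos_of_mem_ball hz))]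

/-- The partial derivative of a bounded separately holomorphic function is jointly continuous. -/
theorem continuousAt_fderiv_left_of_bounded {f : E × F → ℂ} {z₀ : E} {w₀ : F} {ρ M : ℝ}
    (hρ : 0 < ρ)
    (h1 : ∀ w ∈ ball w₀ ρ, DifferentiableOn ℂ (fun z => f (z, w)) (ball z₀ ρ))
    (h2 : ∀ z ∈ ball z₀ ρ, DifferentiableOn ℂ (fun w => f (z, w)) (ball w₀ ρ))
    (hM : ∀ z ∈ ball z₀ ρ, ∀ w ∈ ball w₀ ρ, ‖f (z, w)‖ ≤ M) :
    ContinuousAt (fun v : E × F => fderiv ℂ (fun z => f (z, v.2)) v.1) (z₀, w₀) := by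
  set r := ρ / 3 with hr
  have hr0 : 0 < r := by positivity
  have key : ∀ᶠ v : E × F in 𝓝 (z₀, w₀),
      ‖fderiv ℂ (fun z => f (z, v.2)) v.1 - fderiv ℂ (fun z => f (z, w₀)) z₀‖ ≤
        2 * (2 * M / r * ‖v.1 - z₀‖ + 2 * M / ρ * ‖v.2 - w₀‖) / r := by
    filter_upwards [ball_mem_nhds (z₀, w₀) hr0] with v hv
    rw [← ball_prod_same, mem_prod] at hv
    obtain ⟨hv1, hv2⟩ := hv
    have hv2' : v.2 ∈ ball w₀ ρ := ball_subset_ball (by linarith) hv2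
    have hshift : ∀ x ∈ ball z₀ r, x + (v.1 - z₀) ∈ ball z₀ ρ := by
      intro x hx
      rw [mem_ball_iff_norm] at hx hv1 ⊢
      calc ‖x + (v.1 - z₀) - z₀‖ = ‖(x - z₀) + (v.1 - z₀)‖ := by congr 1; abel
        _ ≤ ‖x - z₀‖ + ‖v.1 - z₀‖ := norm_add_le _ _
        _ < ρ := by linarith
    have hd1 : DifferentiableOn ℂ (fun x => f (x + (v.1 - z₀), v.2)) (ball z₀ r) :=
      (h1 v.2 hv2').comp (f := fun x => x + (v.1 - z₀)) (by fun_prop) hshift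
    have hd2 : DifferentiableOn ℂ (fun x => f (x, w₀)) (ball z₀ r) :=
      (h1 w₀ (mem_ball_self hρ)).mono (ball_subset_ball (by linarith))
    have hnz : ball z₀ r ∈ 𝓝 z₀ := ball_mem_nhds _ hr0
    have heq : fderiv ℂ (fun x => f (x + (v.1 - z₀), v.2) - f (x, w₀)) z₀ =
        fderiv ℂ (fun z => f (z, v.2)) v.1 - fderiv ℂ (fun z => f (z, w₀)) z₀ := by
      rw [fderiv_fun_sub (hd1.differentiableAt hnz) (hd2.differentiableAt hnz),
        fderiv_comp_add_right (f := fun x => f (x, v.2)) (v.1 - z₀), add_sub_cancel]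
    rw [← heq]
    refine norm_fderiv_le_of_norm_le_on_ball hr0 (hd1.sub hd2) fun x hx => ?_
    have hxρ : x ∈ ball z₀ ρ := ball_subset_ball (by linarith) hx
    have hsub : ball x r ⊆ ball z₀ ρ := by
      refine ball_subset_ball' ?_
      rw [mem_ball] at hx
      linarith
    have e1 : ‖f (x + (v.1 - z₀), v.2) - f (x, v.2)‖ ≤ 2 * M / r * ‖v.1 - z₀‖ := by
      have := norm_sub_le_of_norm_le_on_ball (z := x + (v.1 - z₀))
        ((h1 v.2 hv2').mono hsub) (fun y hy => hM y (hsub hy) v.2 hv2')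
        (by rw [mem_ball_iff_norm] at hv1 ⊢; simpa using hv1)
      simpa using this
    have e2 : ‖f (x, v.2) - f (x, w₀)‖ ≤ 2 * M / ρ * ‖v.2 - w₀‖ :=
      norm_sub_le_of_norm_le_on_ball (h2 x hxρ) (fun y hy => hM x hxρ y hy) hv2'
    calc ‖f (x + (v.1 - z₀), v.2) - f (x, w₀)‖
        = ‖(f (x + (v.1 - z₀), v.2) - f (x, v.2)) + (f (x, v.2) - f (x, w₀))‖ := by
          congr 1; ring
      _ ≤ _ := (norm_add_le _ _).trans (add_le_add e1 e2)
  have hc : Continuous fun v : E × F =>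
      2 * (2 * M / r * ‖v.1 - z₀‖ + 2 * M / ρ * ‖v.2 - w₀‖) / r := by fun_prop
  have h0 := hc.tendsto (z₀, w₀)
  simp only [sub_self, norm_zero, mul_zero, add_zero, zero_div] at h0
  exact tendsto_iff_norm_sub_tendsto_zero.2
    (squeeze_zero' (Eventually.of_forall fun _ => norm_nonneg _) key h0)

/-- The same with the roles of the two variables exchanged. -/
theorem continuousAt_fderiv_right_of_bounded {f : E × F → ℂ} {z₀ : E} {w₀ : F} {ρ M : ℝ}
    (hρ : 0 < ρ)
    (h1 : ∀ w ∈ ball w₀ ρ, DifferentiableOn ℂ (fun z => f (z, w)) (ball z₀ ρ))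
    (h2 : ∀ z ∈ ball z₀ ρ, DifferentiableOn ℂ (fun w => f (z, w)) (ball w₀ ρ))
    (hM : ∀ z ∈ ball z₀ ρ, ∀ w ∈ ball w₀ ρ, ‖f (z, w)‖ ≤ M) :
    ContinuousAt (fun v : E × F => fderiv ℂ (fun w => f (v.1, w)) v.2) (z₀, w₀) :=
  ContinuousAt.comp (x := (z₀, w₀)) (f := Prod.swap) (g := fun v : F × E => fderiv ℂ (fun w => f (v.2, w)) v.1)
    (continuousAt_fderiv_left_of_bounded (f := fun v : F × E => f v.swap) hρ h2 h1
      fun w hw z hz => hM z hz w hw) continuous_swap.continuousAt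

/-- **Osgood's lemma**: a bounded separately holomorphic function is jointly holomorphic. -/
theorem differentiableOn_prod_of_bounded {f : E × F → ℂ} {D : Set E} {W : Set F} {M : ℝ}
    (hD : IsOpen D) (hW : IsOpen W)
    (h1 : ∀ w ∈ W, DifferentiableOn ℂ (fun z => f (z, w)) D)
    (h2 : ∀ z ∈ D, DifferentiableOn ℂ (fun w => f (z, w)) W)
    (hM : ∀ z ∈ D, ∀ w ∈ W, ‖f (z, w)‖ ≤ M) : DifferentiableOn ℂ f (D ×ˢ W) := by
  rintro ⟨z₀, w₀⟩ ⟨hz, hw⟩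
  obtain ⟨ρ, hρ, hball⟩ := Metric.isOpen_iff.1 (hD.prod hW) (z₀, w₀) ⟨hz, hw⟩
  rw [← ball_prod_same] at hball
  have hb1 : ball z₀ ρ ⊆ D := fun z hz => (hball (mk_mem_prod hz (mem_ball_self hρ))).1
  have hb2 : ball w₀ ρ ⊆ W := fun w hw => (hball (mk_mem_prod (mem_ball_self hρ) hw)).2
  have h1' : ∀ w ∈ ball w₀ ρ, DifferentiableOn ℂ (fun z => f (z, w)) (ball z₀ ρ) :=
    fun w hw => (h1 w (hb2 hw)).mono hb1
  have h2' : ∀ z ∈ ball z₀ ρ, DifferentiableOn ℂ (fun w => f (z, w)) (ball w₀ ρ) :=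
    fun z hz => (h2 z (hb1 hz)).mono hb2
  have hM' : ∀ z ∈ ball z₀ ρ, ∀ w ∈ ball w₀ ρ, ‖f (z, w)‖ ≤ M :=
    fun z hz w hw => hM z (hb1 hz) w (hb2 hw)
  have hmem : ∀ᶠ v : E × F in 𝓝 (z₀, w₀), v ∈ D ×ˢ W := (hD.prod hW).mem_nhds ⟨hz, hw⟩
  have := hasStrictFDerivAt_uncurry_coprod (𝕜 := ℂ) (u := (z₀, w₀)) (f := fun z w => f (z, w))
    (f₁ := fun z w => fderiv ℂ (fun z => f (z, w)) z)
    (f₂ := fun z w => fderiv ℂ (fun w => f (z, w)) w)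
    (hmem.mono fun v hv =>
      ((h1 v.2 hv.2).differentiableAt (hD.mem_nhds hv.1)).hasFDerivAt)
    (hmem.mono fun v hv =>
      ((h2 v.1 hv.1).differentiableAt (hW.mem_nhds hv.2)).hasFDerivAt)
    (continuousAt_fderiv_left_of_bounded hρ h1' h2' hM')
    (continuousAt_fderiv_right_of_bounded hρ h1' h2' hM')
  exact this.hasFDerivAt.differentiableAt.differentiableWithinAt

end PartialDerivatives

section Coefficients

theorem exists_norm_le_on_closedBall_prod {F : Type*} [NormedAddCommGroup F] [ProperSpace F]
    {g : ℂ × F → ℂ} {P : Set F} {r s : ℝ} (hsr : s < r)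
    (hP : IsOpen P) (hg : ContinuousOn g (ball 0 r ×ˢ P)) {p₀ : F} (hp₀ : p₀ ∈ P) :
    ∃ δ > 0, closedBall p₀ δ ⊆ P ∧
      ∃ M, 1 ≤ M ∧ ∀ z ∈ closedBall (0 : ℂ) s, ∀ p ∈ closedBall p₀ δ, ‖g (z, p)‖ ≤ M := by
  obtain ⟨δ, hδ, hδP⟩ := nhds_basis_closedBall.mem_iff.1 (hP.mem_nhds hp₀)
  obtain ⟨M, hM⟩ := ((isCompact_closedBall (0 : ℂ) s).prod
    (isCompact_closedBall p₀ δ)).exists_bound_of_continuousOn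
      (hg.mono (prod_mono (closedBall_subset_ball hsr) hδP))
  exact ⟨δ, hδ, hδP, max M 1, le_max_right _ _,
    fun z hz p hp => (hM (z, p) ⟨hz, hp⟩).trans (le_max_left _ _)⟩

variable {F : Type*} [NormedAddCommGroup F] [NormedSpace ℂ F] [ProperSpace F]

/-- The Taylor coefficients in one variable of a jointly holomorphic function are holomorphic in
the remaining variables. -/
theorem differentiableOn_iteratedDeriv_left {g : ℂ × F → ℂ} {P : Set F} {r : ℝ} (hr : 0 < r)
    (hP : IsOpen P) (hg : DifferentiableOn ℂ g (ball 0 r ×ˢ P)) (k : ℕ) :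
    DifferentiableOn ℂ (fun p => iteratedDeriv k (fun z => g (z, p)) 0) P := by
  have hg1 : ∀ p ∈ P, DifferentiableOn ℂ (fun z => g (z, p)) (ball 0 r) := fun p hp =>
    hg.comp (f := fun z => (z, p)) (by fun_prop) fun z hz => ⟨hz, hp⟩
  have hg2 : ∀ z ∈ ball (0 : ℂ) r, DifferentiableOn ℂ (fun p => g (z, p)) P := fun z hz =>
    hg.comp (f := fun p => (z, p)) (by fun_prop) fun p hp => ⟨hz, hp⟩
  set s := r / 2 with hs
  have hs0 : 0 < s := by positivity
  have hCauchy : ∀ p ∈ P, iteratedDeriv k (fun z => g (z, p)) 0 =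
      (2 * Real.pi * Complex.I / k.factorial : ℂ)⁻¹ *
        ∮ z in C(0, s), (1 / (z - 0) ^ (k + 1)) • g (z, p) := by
    intro p hp
    have hne : (2 * Real.pi * Complex.I / k.factorial : ℂ) ≠ 0 := by
      simp [Nat.factorial_ne_zero, Real.pi_ne_zero]
    have hd : DiffContOnCl ℂ (fun z => g (z, p)) (ball 0 s) :=
      (hg1 p hp).diffContOnCl_ball (closedBall_subset_ball (by linarith))
    rw [hd.circleIntegral_one_div_sub_center_pow_smul hs0 k, smul_eq_mul,
      inv_mul_cancel_left₀ hne]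
  refine DifferentiableOn.congr (DifferentiableOn.const_mul ?_ _) hCauchy
  intro p₀ hp₀
  obtain ⟨δ, hδ, hδP, M, -, hM⟩ :=
    exists_norm_le_on_closedBall_prod (s := 3 * r / 4) (by linarith) hP hg.continuousOn hp₀
  have hcirc : ∀ θ, circleMap 0 s θ ∈ sphere (0 : ℂ) s := circleMap_mem_sphere 0 hs0.le
  have hcirc_ball : ∀ θ, circleMap 0 s θ ∈ ball (0 : ℂ) r := fun θ =>
    closedBall_subset_ball (by linarith) (sphere_subset_closedBall (hcirc θ))
  have hcirc_closedBall : ∀ θ, circleMap 0 s θ ∈ closedBall (0 : ℂ) (3 * r / 4) := fun θ =>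
    closedBall_subset_closedBall (by linarith) (sphere_subset_closedBall (hcirc θ))
  have hcirc0 : ∀ θ, circleMap 0 s θ ≠ 0 := fun θ => circleMap_ne_center hs0.ne'
  let c : ℝ → ℂ := fun θ => deriv (circleMap 0 s) θ * (1 / (circleMap 0 s θ) ^ (k + 1))
  have hc : Continuous c := by
    have h1 : Continuous (deriv (circleMap 0 s)) := by
      rw [show deriv (circleMap 0 s) = fun θ => circleMap 0 s θ * Complex.I from
        funext fun θ => deriv_circleMap 0 s θ]
      fun_prop
    exact h1.mul (continuous_const.div ((continuous_circleMap 0 s).pow _)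
      fun θ => pow_ne_zero _ (hcirc0 θ))
  have hgc : ∀ p ∈ P, Continuous fun θ => c θ * g (circleMap 0 s θ, p) := fun p hp =>
    hc.mul ((hg1 p hp).continuousOn.comp_continuous (continuous_circleMap 0 s) hcirc_ball)
  have hfd : Continuous fun θ =>
      c θ • fderiv ℂ (fun p => g (circleMap 0 s θ, p)) p₀ := by
    refine hc.smul (continuous_iff_continuousAt.2 fun θ => ?_)
    have hb1 : ball (circleMap 0 s θ) (min (r / 4) δ) ⊆ ball (0 : ℂ) (3 * r / 4) := by
      refine ball_subset_ball' ?_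
      have := mem_sphere.1 (hcirc θ)
      linarith [min_le_left (r / 4) δ]
    have hb2 : ball p₀ (min (r / 4) δ) ⊆ closedBall p₀ δ :=
      (ball_subset_ball (min_le_right _ _)).trans ball_subset_closedBall
    have hb3 : ball (0 : ℂ) (3 * r / 4) ⊆ ball (0 : ℂ) r := ball_subset_ball (by linarith)
    exact ContinuousAt.comp (f := fun θ => (circleMap 0 s θ, p₀))
      (g := fun v : ℂ × F => fderiv ℂ (fun w => g (v.1, w)) v.2)
      (continuousAt_fderiv_right_of_bounded (by positivity)
        (fun w hw => (hg1 w (hδP (hb2 hw))).mono (hb1.trans hb3))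
        (fun z hz => (hg2 z (hb3 (hb1 hz))).mono (hb2.trans hδP))
        fun z hz w hw => hM z (ball_subset_closedBall (hb1 hz)) w (hb2 hw))
      (by fun_prop)
  have hnear : ball p₀ (δ / 2) ∈ 𝓝 p₀ := ball_mem_nhds _ (by positivity)
  have hsub : ∀ p ∈ ball p₀ (δ / 2), ball p (δ / 2) ⊆ closedBall p₀ δ := by
    intro p hp
    refine (ball_subset_ball' ?_).trans ball_subset_closedBall
    linarith [mem_ball.1 hp]
  have hmain := intervalIntegral.hasFDerivAt_integral_of_dominated_of_fderiv_le
    (μ := volume) (a := 0) (b := 2 * Real.pi) (𝕜 := ℂ) (x₀ := p₀) hnear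
    (F := fun p θ => c θ * g (circleMap 0 s θ, p))
    (F' := fun p θ => c θ • fderiv ℂ (fun p => g (circleMap 0 s θ, p)) p)
    (bound := fun θ => ‖c θ‖ * (2 * M / (δ / 2)))
    (by
      filter_upwards [hP.mem_nhds hp₀] with p hp
      exact (hgc p hp).aestronglyMeasurable)
    ((hgc p₀ hp₀).intervalIntegrable _ _)
    hfd.aestronglyMeasurable
    (Eventually.of_forall fun θ _ p hp => by
      rw [norm_smul]
      refine mul_le_mul_of_nonneg_left ?_ (norm_nonneg _)
      exact norm_fderiv_le_of_norm_le_on_ball (by positivity)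
        ((hg2 _ (hcirc_ball θ)).mono ((hsub p hp).trans hδP))
        fun x hx => hM _ (hcirc_closedBall θ) x (hsub p hp hx))
    ((hc.norm.mul continuous_const).intervalIntegrable _ _)
    (Eventually.of_forall fun θ _ p hp =>
      (((hg2 _ (hcirc_ball θ)).differentiableAt (hP.mem_nhds
        (hδP (hsub p hp (mem_ball_self (by positivity)))))).hasFDerivAt.const_mul (c θ)))
  refine DifferentiableAt.differentiableWithinAt ?_
  refine hmain.differentiableAt.congr_of_eventuallyEq (Eventually.of_forall fun p => ?_)
  simp only [circleIntegral, c, sub_zero, smul_eq_mul, mul_assoc]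

end Coefficients

section Averaging

/-- A two-constant estimate obtained from Jensen's formula. -/
theorem norm_center_le_rpow_of_norm_le_one_off {h : ℂ → ℂ}
    (hh : AnalyticOnNhd ℂ h (closedBall 0 1)) {B t : ℝ} (hB1 : 1 ≤ B) {S : Set ℝ}
    (hS : MeasurableSet S) (hB : ∀ θ, ‖h (circleMap 0 1 θ)‖ ≤ B)
    (h1 : ∀ θ, θ ∉ S → ‖h (circleMap 0 1 θ)‖ ≤ 1)
    (ht : volume.real (S ∩ Ioc 0 (2 * Real.pi)) ≤ 2 * Real.pi * t) : ‖h 0‖ ≤ B ^ t := by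
  rcases eq_or_ne (h 0) 0 with h0 | h0
  · rw [h0, norm_zero]
    positivity
  have hB0 : 0 < B := by linarith
  have hlogB : 0 ≤ Real.log B := Real.log_nonneg hB1
  have hJ := AnalyticOnNhd.circleAverage_log_norm (c := 0) (R := 1) one_ne_zero
    (by simpa using hh) h0
  have hnonneg : 0 ≤ ∑ᶠ u, (MeromorphicOn.divisor h (closedBall 0 |1|) u : ℝ) *
      Real.log (1 * ‖0 - u‖⁻¹) := by
    refine finsum_nonneg fun u => ?_
    by_cases hu : u ∈ closedBall (0 : ℂ) |1|
    · refine mul_nonneg ?_ ?_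
      · have hd := MeromorphicOn.AnalyticOnNhd.divisor_nonneg (f := h) (U := closedBall 0 |1|)
          (by simpa using hh)
        exact_mod_cast hd u
      · rw [mem_closedBall, dist_zero_right, abs_one] at hu
        rw [one_mul, zero_sub, norm_neg, Real.log_inv]
        linarith [Real.log_nonpos (norm_nonneg u) hu]
    · rw [Function.locallyFinsuppWithin.apply_eq_zero_of_notMem _ hu]
      simp
  have hint : CircleIntegrable (fun z => Real.log ‖h z‖) 0 1 := by
    refine MeromorphicOn.circleIntegrable_log_norm ?_
    exact (hh.mono (by simpa using sphere_subset_closedBall)).meromorphicOn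
  have hle : ∀ θ, Real.log ‖h (circleMap 0 1 θ)‖ ≤ S.indicator (fun _ => Real.log B) θ := by
    intro θ
    rcases eq_or_ne (h (circleMap 0 1 θ)) 0 with hz | hz
    · rw [hz, norm_zero, Real.log_zero]
      exact indicator_nonneg (fun _ _ => hlogB) θ
    · by_cases hθ : θ ∈ S
      · rw [indicator_of_mem hθ]
        exact Real.log_le_log (norm_pos_iff.2 hz) (hB θ)
      · rw [indicator_of_notMem hθ]
        exact Real.log_nonpos (norm_nonneg _) (h1 θ hθ)
  have h2π : (0 : ℝ) < 2 * Real.pi := by positivity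
  have havg : Real.circleAverage (fun z => Real.log ‖h z‖) 0 1 ≤ t * Real.log B := by
    rw [Real.circleAverage_def, smul_eq_mul, inv_mul_le_iff₀ h2π]
    calc ∫ θ in 0..2 * Real.pi, Real.log ‖h (circleMap 0 1 θ)‖
        ≤ ∫ θ in 0..2 * Real.pi, S.indicator (fun _ => Real.log B) θ := by
          refine intervalIntegral.integral_mono_on h2π.le hint ?_ fun θ _ => hle θ
          rw [intervalIntegrable_iff_integrableOn_Ioc_of_le h2π.le]
          exact (integrableOn_const measure_Ioc_lt_top.ne).indicator hS
      _ = volume.real (S ∩ Ioc 0 (2 * Real.pi)) * Real.log B := by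
          rw [intervalIntegral.integral_of_le h2π.le, integral_indicator hS,
            setIntegral_const, Measure.real, Measure.real, Measure.restrict_apply hS,
            smul_eq_mul]
      _ ≤ 2 * Real.pi * t * Real.log B := by gcongr
      _ = 2 * Real.pi * (t * Real.log B) := by ring
  have hfin : Real.log ‖h 0‖ ≤ t * Real.log B := by linarith
  rw [← Real.log_rpow hB0] at hfin
  exact (Real.log_le_log_iff (norm_pos_iff.2 h0) (by positivity)).1 hfin

variable {E : Type*} [NormedAddCommGroup E] [NormedSpace ℂ E] [ProperSpace E]
  [MeasurableSpace E] [BorelSpace E] (μ : Measure E) [μ.IsAddHaarMeasure]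

theorem measurePreserving_smul_of_norm_eq_one {c : ℂ} (hc : ‖c‖ = 1) :
    MeasurePreserving (fun x : E => c • x) μ μ := by
  have hc0 : c ≠ 0 := by
    rintro rfl
    simp at hc
  refine ⟨measurable_const_smul c, ?_⟩
  have : (μ.map (fun x : E => c • x)).IsAddHaarMeasure :=
    (ContinuousLinearEquiv.smulLeft (R₁ := ℂ) (M₁ := E) (Units.mk0 c hc0)).isAddHaarMeasure_map μ
  have heq := Measure.isAddLeftInvariant_eq_smul (μ.map (fun x : E => c • x)) μ
  have hball : (fun x : E => c • x) ⁻¹' ball 0 1 = ball 0 1 := by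
    ext x
    simp [norm_smul, hc]
  have h1 := congrArg (fun ν : Measure E => ν (ball 0 1)) heq
  simp only [Measure.map_apply (measurable_const_smul c) measurableSet_ball, hball,
    Measure.smul_apply] at h1
  have hpos : μ (ball 0 1) ≠ 0 := (measure_ball_pos μ _ one_pos).ne'
  have hfin : μ (ball 0 1) ≠ ⊤ := measure_ball_lt_top.ne
  have hone : (Measure.addHaarScalarFactor (μ.map (fun x : E => c • x)) μ) = 1 := by
    rw [ENNReal.smul_def, smul_eq_mul] at h1
    have := (ENNReal.mul_eq_right hpos hfin).1 h1.symm
    exact_mod_cast this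
  rw [heq, hone, one_smul]

/-- If a set fills only a small part of a ball, then some circle centered at the center of the
ball meets it in a set of small measure. -/
theorem exists_circle_volume_le {S : Set E} (hS : MeasurableSet S) (p : E) {ρ t : ℝ} (hρ : 0 < ρ)
    (hμ : μ (S ∩ ball p ρ) ≤ ENNReal.ofReal t * μ (ball 0 ρ)) :
    ∃ x ∈ ball (0 : E) ρ,
      volume ({θ : ℝ | p + circleMap 0 1 θ • x ∈ S} ∩ Ioc 0 (2 * Real.pi)) ≤
        ENNReal.ofReal (2 * Real.pi) * ENNReal.ofReal t := by
  have hpos : μ (ball 0 ρ) ≠ 0 := (measure_ball_pos μ _ hρ).ne'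
  have hfin : μ (ball 0 ρ) ≠ ⊤ := measure_ball_lt_top.ne
  let T : Set (E × ℝ) := {v | p + circleMap 0 1 v.2 • v.1 ∈ S}
  have hT : MeasurableSet T :=
    (Continuous.measurable (by fun_prop :
      Continuous fun v : E × ℝ => p + circleMap 0 1 v.2 • v.1)) hS
  let ν : Measure ℝ := volume.restrict (Ioc 0 (2 * Real.pi))
  have hslice : ∀ x : E, volume ({θ : ℝ | p + circleMap 0 1 θ • x ∈ S} ∩ Ioc 0 (2 * Real.pi)) =
      ν (Prod.mk x ⁻¹' T) := fun x =>
    (Measure.restrict_apply (measurable_prodMk_left hT)).symm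
  have hmeas : Measurable fun x : E => ν (Prod.mk x ⁻¹' T) := measurable_measure_prodMk_left hT
  obtain ⟨x, hx, hle⟩ := exists_le_setLAverage hpos hfin hmeas.aemeasurable
  refine ⟨x, hx, (hslice x).le.trans (hle.trans ?_)⟩
  rw [setLAverage_eq, ENNReal.div_le_iff hpos hfin, ← Measure.prod_apply hT,
    Measure.prod_apply_symm hT]
  have hcircle : ∀ θ : ℝ, (μ.restrict (ball 0 ρ)) ((fun x => (x, θ)) ⁻¹' T) =
      μ (S ∩ ball p ρ) := by
    intro θ
    have hmp : MeasurePreserving (fun x : E => p + circleMap 0 1 θ • x) μ μ :=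
      (measurePreserving_add_left μ p).comp
        (measurePreserving_smul_of_norm_eq_one μ (by simp [norm_circleMap_zero]))
    rw [Measure.restrict_apply (measurable_prodMk_right hT),
      ← hmp.measure_preimage (hS.inter measurableSet_ball).nullMeasurableSet]
    congr 1
    ext x
    simp [T, norm_smul, norm_circleMap_zero]
  simp only [hcircle, lintegral_const]
  have hν : ν univ = ENNReal.ofReal (2 * Real.pi) := by simp [ν]
  rw [hν]
  calc μ (S ∩ ball p ρ) * ENNReal.ofReal (2 * Real.pi)
      ≤ ENNReal.ofReal t * μ (ball 0 ρ) * ENNReal.ofReal (2 * Real.pi) := by gcongr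
    _ = _ := by ring

end Averaging

section Extension

variable {E F : Type*} [NormedAddCommGroup E] [NormedSpace ℂ E]
  [NormedAddCommGroup F] [NormedSpace ℂ F]

/-- **Hartogs' lemma** for the coefficients of a power series: a locally uniform geometric bound
together with a better pointwise one gives a locally uniform bound which is almost as good. -/
theorem exists_uniform_bound_of_eventually_bound [ProperSpace E] {a : ℕ → E → ℂ} {p₀ : E}
    {δ s R₁ R₂ M : ℝ} (hδ : 0 < δ) (hs : 0 < s) (hsR : s ≤ R₂) (hR : R₂ < R₁) (hM1 : 1 ≤ M)
    (ha : ∀ k, DifferentiableOn ℂ (a k) (ball p₀ δ))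
    (hM : ∀ k, ∀ p ∈ ball p₀ δ, ‖a k p‖ * s ^ k ≤ M)
    (hev : ∀ p ∈ ball p₀ δ, ∀ᶠ k in atTop, ‖a k p‖ * R₁ ^ k ≤ 1) :
    ∃ C, ∀ k, ∀ p ∈ ball p₀ (δ / 2), ‖a k p‖ * R₂ ^ k ≤ C := by
  borelize E
  let μ : Measure E := Measure.addHaar
  have hR2 : 0 < R₂ := hs.trans_le hsR
  have hR1 : 0 < R₁ := hR2.trans hR
  have hρ : 0 < δ / 2 := by positivity
  have hlog : 0 < Real.log (R₁ / s) := Real.log_pos ((one_lt_div hs).2 (by linarith))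
  set t := Real.log (R₁ / R₂) / Real.log (R₁ / s) with ht
  have ht0 : 0 < t := div_pos (Real.log_pos ((one_lt_div hR2).2 hR)) hlog
  have htpow : (R₁ / s) ^ t = R₁ / R₂ := by
    rw [Real.rpow_def_of_pos (by positivity), ht, mul_div_cancel₀ _ hlog.ne',
      Real.exp_log (by positivity)]
  let S : ℕ → Set E := fun k => ⋃ j ≥ k, ball p₀ δ ∩ {p | 1 < ‖a j p‖ * R₁ ^ j}
  have hSopen : ∀ k, IsOpen (S k) := fun k => isOpen_biUnion fun j _ =>
    ((ha j).continuousOn.norm.mul continuousOn_const).isOpen_inter_preimage isOpen_ball isOpen_Ioi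
  have hSanti : Antitone S := fun i j hij =>
    biUnion_subset_biUnion_left fun l (hl : j ≤ l) => hij.trans hl
  have hSsub : ∀ k, S k ⊆ ball p₀ δ := fun k => iUnion₂_subset fun j _ => inter_subset_left
  have hSempty : ⋂ k, S k = ∅ := by
    refine eq_empty_of_forall_notMem fun p hp => ?_
    rw [mem_iInter] at hp
    obtain ⟨K, hK⟩ := eventually_atTop.1 (hev p (hSsub 0 (hp 0)))
    obtain ⟨j, hj, -, hj'⟩ := mem_iUnion₂.1 (hp K)
    exact absurd (hK j hj) (not_le.2 hj')
  have hlim : Tendsto (μ ∘ S) atTop (𝓝 0) := by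
    have := tendsto_measure_iInter_atTop (μ := μ)
      (fun k => (hSopen k).measurableSet.nullMeasurableSet) hSanti
      ⟨0, ((measure_mono (hSsub 0)).trans_lt measure_ball_lt_top).ne⟩
    rwa [hSempty, measure_empty] at this
  have hpos : 0 < ENNReal.ofReal t * μ (ball 0 (δ / 2)) :=
    ENNReal.mul_pos (ENNReal.ofReal_pos.2 ht0).ne' (measure_ball_pos μ _ hρ).ne'
  obtain ⟨K, hK⟩ := (hlim.eventually (eventually_le_nhds hpos)).exists
  have hlarge : ∀ j ≥ K, ∀ p ∈ ball p₀ (δ / 2), ‖a j p‖ * R₂ ^ j ≤ M ^ t := by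
    intro j hj p hp
    obtain ⟨x, hx, hvol⟩ := exists_circle_volume_le μ (hSopen K).measurableSet p hρ
      ((measure_mono inter_subset_left).trans hK)
    have hmaps : ∀ ζ ∈ closedBall (0 : ℂ) 1, p + ζ • x ∈ ball p₀ δ := by
      intro ζ hζ
      rw [mem_closedBall_zero_iff] at hζ
      rw [mem_ball_zero_iff] at hx
      rw [mem_ball_iff_norm] at hp ⊢
      calc ‖p + ζ • x - p₀‖ = ‖(p - p₀) + ζ • x‖ := by congr 1; abel
        _ ≤ ‖p - p₀‖ + ‖ζ‖ * ‖x‖ := (norm_add_le _ _).trans_eq (by rw [norm_smul])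
        _ ≤ ‖p - p₀‖ + 1 * ‖x‖ := by gcongr
        _ < δ := by linarith
    have hcont : Continuous fun ζ : ℂ => p + ζ • x := by fun_prop
    have hopen : IsOpen ((fun ζ : ℂ => p + ζ • x) ⁻¹' ball p₀ δ) := isOpen_ball.preimage hcont
    have hdiff : DifferentiableOn ℂ (fun ζ : ℂ => a j (p + ζ • x) * (R₁ : ℂ) ^ j)
        ((fun ζ : ℂ => p + ζ • x) ⁻¹' ball p₀ δ) :=
      ((ha j).comp (f := fun ζ : ℂ => p + ζ • x) (by fun_prop) fun ζ hζ => hζ).mul_const _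
    have hnorm : ∀ q, ‖a j q * (R₁ : ℂ) ^ j‖ = ‖a j q‖ * R₁ ^ j := fun q => by
      rw [norm_mul, norm_pow, Complex.norm_real, Real.norm_of_nonneg hR1.le]
    have hcirc : ∀ θ, circleMap 0 1 θ ∈ closedBall (0 : ℂ) 1 :=
      circleMap_mem_closedBall 0 zero_le_one
    have hj1 : 1 ≤ (R₁ / s) ^ j := one_le_pow₀ ((one_le_div hs).2 (by linarith))
    have hest := norm_center_le_rpow_of_norm_le_one_off
      (h := fun ζ : ℂ => a j (p + ζ • x) * (R₁ : ℂ) ^ j) (B := M * (R₁ / s) ^ j) (t := t)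
      (S := {θ : ℝ | p + circleMap 0 1 θ • x ∈ S K})
      (fun ζ hζ => hdiff.analyticAt (hopen.mem_nhds (hmaps ζ hζ)))
      (one_le_mul_of_one_le_of_one_le hM1 hj1)
      ((hSopen K).preimage (by fun_prop : Continuous fun θ : ℝ => p + circleMap 0 1 θ • x)
        |>.measurableSet)
      (fun θ => by
        rw [hnorm, div_pow, ← mul_div_assoc, le_div_iff₀ (by positivity)]
        have := hM j _ (hmaps _ (hcirc θ))
        calc ‖a j (p + circleMap 0 1 θ • x)‖ * R₁ ^ j * s ^ j
            = ‖a j (p + circleMap 0 1 θ • x)‖ * s ^ j * R₁ ^ j := by ring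
          _ ≤ M * R₁ ^ j := by gcongr)
      (fun θ hθ => by
        rw [hnorm]
        by_contra! hcon
        exact hθ (mem_iUnion₂.2 ⟨j, hj, hmaps _ (hcirc θ), hcon⟩))
      (by
        refine ENNReal.toReal_le_of_le_ofReal (by positivity) (hvol.trans_eq ?_)
        rw [ENNReal.ofReal_mul (p := 2 * Real.pi) (by positivity)])
    simp only [zero_smul, add_zero] at hest
    rw [hnorm, Real.mul_rpow (by linarith) (by positivity), ← Real.rpow_pow_comm (by positivity),
      htpow, div_pow, ← mul_div_assoc, le_div_iff₀ (by positivity)] at hest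
    refine le_of_mul_le_mul_right ?_ (pow_pos hR1 j)
    calc ‖a j p‖ * R₂ ^ j * R₁ ^ j = ‖a j p‖ * R₁ ^ j * R₂ ^ j := by ring
      _ ≤ M ^ t * R₁ ^ j := hest
  refine ⟨max (M ^ t) (M * (R₂ / s) ^ K), fun k p hp => ?_⟩
  rcases le_or_gt K k with hk | hk
  · exact (hlarge k hk p hp).trans (le_max_left _ _)
  · refine le_trans ?_ (le_max_right _ _)
    have h1 : 1 ≤ R₂ / s := (one_le_div hs).2 hsR
    calc ‖a k p‖ * R₂ ^ k = ‖a k p‖ * s ^ k * (R₂ / s) ^ k := by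
          rw [div_pow]
          field_simp
      _ ≤ M * (R₂ / s) ^ K := by
          gcongr
          exact hM k p (ball_subset_ball (by linarith) hp)

/-- A normally convergent series of holomorphic functions is holomorphic. -/
theorem differentiableOn_tsum_of_norm_le {f : ℕ → E → ℂ} {u : ℕ → ℝ} {s : Set E}
    (hu : Summable u) (hs : IsOpen s) (hf : ∀ k, DifferentiableOn ℂ (f k) s)
    (hfu : ∀ k, ∀ x ∈ s, ‖f k x‖ ≤ u k) : DifferentiableOn ℂ (fun x => ∑' k, f k x) s := by
  intro x hx
  obtain ⟨ε, hε, hεs⟩ := Metric.isOpen_iff.1 hs x hx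
  have hsub : ∀ y ∈ ball x (ε / 2), ball y (ε / 2) ⊆ s := by
    intro y hy
    refine (ball_subset_ball' ?_).trans hεs
    linarith [mem_ball.1 hy]
  have hx' : x ∈ ball x (ε / 2) := mem_ball_self (by positivity)
  refine (hasFDerivAt_tsum_of_isPreconnected (𝕜 := ℂ) (u := fun k => 2 * u k / (ε / 2))
    (f' := fun k y => fderiv ℂ (f k) y) ((hu.mul_left 2).div_const _) isOpen_ball
    (convex_ball x (ε / 2)).isPreconnected (fun k y hy => ?_) (fun k y hy => ?_) hx'
    (Summable.of_norm_bounded hu fun k => hfu k x hx)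
    hx').differentiableAt.differentiableWithinAt
  · exact ((hf k).differentiableAt (hs.mem_nhds
      (hsub y hy (mem_ball_self (by positivity))))).hasFDerivAt
  · exact norm_fderiv_le_of_norm_le_on_ball (by positivity) ((hf k).mono (hsub y hy))
      fun z hz => hfu k z (hsub y hy hz)

/-- A function which is jointly holomorphic on a thin cylinder and holomorphic on the large discs
is jointly holomorphic on the large cylinder. -/
theorem differentiableOn_disc_prod_of_slices [ProperSpace E] {g : ℂ × E → ℂ} {P : Set E} {r R : ℝ}
    (hr : 0 < r) (hP : IsOpen P) (hg : DifferentiableOn ℂ g (ball 0 r ×ˢ P))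
    (hslice : ∀ p ∈ P, DifferentiableOn ℂ (fun z => g (z, p)) (ball 0 R)) :
    DifferentiableOn ℂ g (ball 0 R ×ˢ P) := by
  rcases le_or_gt R r with hRr | hrR
  · exact hg.mono (prod_mono_left (ball_subset_ball hRr))
  rintro ⟨z₀, p₀⟩ ⟨hz₀, hp₀⟩
  rw [mem_ball_zero_iff] at hz₀
  obtain ⟨R₃, hzR₃, hR₃⟩ := exists_between (max_lt hz₀ (by linarith : r / 2 < R))
  obtain ⟨R₂, hR₃₂, hR₂⟩ := exists_between hR₃
  obtain ⟨R₁, hR₂₁, hR₁⟩ := exists_between hR₂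
  obtain ⟨R₀, hR₁₀, hR₀⟩ := exists_between hR₁
  obtain ⟨hzR₃, hrR₃⟩ := max_lt_iff.1 hzR₃
  have hs : 0 < r / 2 := by positivity
  have hR₃pos : 0 < R₃ := hs.trans hrR₃
  have hR₂pos : 0 < R₂ := hR₃pos.trans hR₃₂
  obtain ⟨δ, hδ, hδP, M, hM1, hM⟩ :=
    exists_norm_le_on_closedBall_prod (s := r / 2) (by linarith) hP hg.continuousOn hp₀
  have hδP' : ball p₀ δ ⊆ P := ball_subset_closedBall.trans hδP
  let a : ℕ → E → ℂ := fun k p => (k.factorial : ℂ)⁻¹ * iteratedDeriv k (fun z => g (z, p)) 0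
  have ha : ∀ k, DifferentiableOn ℂ (a k) P := fun k =>
    (differentiableOn_iteratedDeriv_left hr hP hg k).const_mul _
  have hCauchy : ∀ p ∈ P, ∀ ρ C : ℝ, 0 < ρ → ρ < R → (∀ z ∈ sphere (0 : ℂ) ρ, ‖g (z, p)‖ ≤ C) →
      ∀ k, ‖a k p‖ * ρ ^ k ≤ C := by
    intro p hp ρ C hρ hρR hC k
    have h := Complex.norm_iteratedDeriv_le_of_forall_mem_sphere_norm_le k hρ
      ((hslice p hp).diffContOnCl_ball (closedBall_subset_ball hρR)) hC
    have hk : (0 : ℝ) < k.factorial := by positivity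
    rw [← le_div_iff₀ (by positivity)]
    simp only [a, norm_mul, norm_inv, Complex.norm_natCast]
    rw [inv_mul_le_iff₀ hk, ← mul_div_assoc]
    exact h
  obtain ⟨C, hC⟩ := exists_uniform_bound_of_eventually_bound (a := a) (p₀ := p₀) hδ hs
    (hrR₃.trans hR₃₂).le hR₂₁ hM1 (fun k => (ha k).mono hδP')
    (fun k p hp => hCauchy p (hδP' hp) _ M hs (by linarith)
      (fun z hz => hM z (sphere_subset_closedBall hz) p (ball_subset_closedBall hp)) k)
    (fun p hp => by
      obtain ⟨B, hB⟩ := (isCompact_sphere (0 : ℂ) R₀).exists_bound_of_continuousOn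
        ((hslice p (hδP' hp)).continuousOn.mono
          (sphere_subset_closedBall.trans (closedBall_subset_ball hR₀)))
      have hR₁pos : 0 < R₁ := by linarith
      have hR₀pos : 0 < R₀ := by linarith
      have hlim : Tendsto (fun k : ℕ => B * (R₁ / R₀) ^ k) atTop (𝓝 (B * 0)) :=
        (tendsto_pow_atTop_nhds_zero_of_lt_one (by positivity)
          ((div_lt_one hR₀pos).2 hR₁₀)).const_mul B
      rw [mul_zero] at hlim
      filter_upwards [hlim.eventually (eventually_le_nhds one_pos)] with k hk
      refine le_trans ?_ hk
      have := hCauchy p (hδP' hp) R₀ B hR₀pos hR₀ hB k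
      calc ‖a k p‖ * R₁ ^ k = ‖a k p‖ * R₀ ^ k * (R₁ / R₀) ^ k := by
            rw [div_pow]
            field_simp
        _ ≤ B * (R₁ / R₀) ^ k := by gcongr)
  have hsub : ball p₀ (δ / 2) ⊆ P := (ball_subset_ball (by linarith)).trans hδP'
  have hseries := differentiableOn_tsum_of_norm_le (f := fun k (v : ℂ × E) => a k v.2 * v.1 ^ k)
    (u := fun k => C * (R₃ / R₂) ^ k) (s := ball 0 R₃ ×ˢ ball p₀ (δ / 2))
    ((summable_geometric_of_lt_one (by positivity)
      ((div_lt_one hR₂pos).2 hR₃₂)).mul_left C)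
    (isOpen_ball.prod isOpen_ball)
    (fun k => ((ha k).comp differentiableOn_snd fun v hv => hsub hv.2).mul
      (differentiableOn_fst.pow k))
    (fun k v hv => by
      have hv1 := mem_ball_zero_iff.1 hv.1
      have h := hC k v.2 hv.2
      calc ‖a k v.2 * v.1 ^ k‖ = ‖a k v.2‖ * ‖v.1‖ ^ k := by rw [norm_mul, norm_pow]
        _ ≤ ‖a k v.2‖ * R₃ ^ k := by gcongr
        _ = ‖a k v.2‖ * R₂ ^ k * (R₃ / R₂) ^ k := by
            rw [div_pow]
            field_simp
        _ ≤ C * (R₃ / R₂) ^ k := by gcongr)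
  have hnhds : ball (0 : ℂ) R₃ ×ˢ ball p₀ (δ / 2) ∈ 𝓝 (z₀, p₀) :=
    (isOpen_ball.prod isOpen_ball).mem_nhds
      ⟨mem_ball_zero_iff.2 hzR₃, mem_ball_self (by positivity)⟩
  have heq : g =ᶠ[𝓝 (z₀, p₀)] fun v => ∑' k, a k v.2 * v.1 ^ k := by
    filter_upwards [hnhds] with v hv
    have h := Complex.taylorSeries_eq_on_ball' (c := 0) (z := v.1)
      (ball_subset_ball hR₃.le hv.1) (hslice v.2 (hsub hv.2))
    simp only [sub_zero] at h
    exact h.symm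
  exact ((hseries.differentiableAt hnhds).congr_of_eventuallyEq heq).differentiableWithinAt

/-- The same for balls in several variables. -/
theorem differentiableOn_ball_prod_of_slices [ProperSpace E] [ProperSpace F] {f : E × F → ℂ}
    {W : Set F} {z₀ : E} {r R : ℝ} (hr : 0 < r) (hW : IsOpen W)
    (hf : DifferentiableOn ℂ f (ball z₀ r ×ˢ W))
    (hslice : ∀ w ∈ W, DifferentiableOn ℂ (fun z => f (z, w)) (ball z₀ R)) :
    DifferentiableOn ℂ f (ball z₀ R ×ˢ W) := by
  rintro ⟨z₁, w₁⟩ ⟨hz₁, hw₁⟩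
  rw [mem_ball_iff_norm] at hz₁
  obtain ⟨R', hzR', hR'⟩ := exists_between hz₁
  have hR'0 : 0 < R' := (norm_nonneg _).trans_lt hzR'
  have hmaps : ∀ ρ : ℝ, ∀ ζ ∈ ball (0 : ℂ) (ρ / R'), ∀ x ∈ ball (0 : E) R',
      z₀ + ζ • x ∈ ball z₀ ρ := by
    intro ρ ζ hζ x hx
    rw [mem_ball_zero_iff, lt_div_iff₀ hR'0] at hζ
    rw [mem_ball_zero_iff] at hx
    rw [mem_ball_iff_norm, add_sub_cancel_left, norm_smul]
    exact (mul_le_mul_of_nonneg_left hx.le (norm_nonneg _)).trans_lt hζ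
  have hext := differentiableOn_disc_prod_of_slices
    (g := fun v : ℂ × (E × F) => f (z₀ + v.1 • v.2.1, v.2.2)) (P := ball 0 R' ×ˢ W)
    (r := r / R') (R := R / R') (by positivity) (isOpen_ball.prod hW)
    (hf.comp (f := fun v : ℂ × (E × F) => (z₀ + v.1 • v.2.1, v.2.2)) (by fun_prop)
      fun v hv => ⟨hmaps r v.1 hv.1 v.2.1 hv.2.1, hv.2.2⟩)
    (fun p hp => (hslice p.2 hp.2).comp (f := fun ζ : ℂ => z₀ + ζ • p.1) (by fun_prop)
      fun ζ hζ => hmaps R ζ hζ p.1 hp.1)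
  have hmem : ((1 : ℂ), (z₁ - z₀, w₁)) ∈ ball (0 : ℂ) (R / R') ×ˢ (ball (0 : E) R' ×ˢ W) :=
    ⟨by rw [mem_ball_zero_iff, norm_one]; exact (one_lt_div hR'0).2 hR',
      mem_ball_zero_iff.2 hzR', hw₁⟩
  have hat := hext.differentiableAt
    ((isOpen_ball.prod (isOpen_ball.prod hW)).mem_nhds hmem)
  have hcomp := DifferentiableAt.comp (x := (z₁, w₁))
    (f := fun v : E × F => ((1 : ℂ), (v.1 - z₀, v.2))) hat (by fun_prop)
  refine DifferentiableAt.differentiableWithinAt (hcomp.congr_of_eventuallyEq ?_)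
  exact Eventually.of_forall fun v => by simp

/-- Joint holomorphy propagates from an open subset of a connected open set. -/
theorem differentiableOn_prod_of_isPreconnected [ProperSpace E] [ProperSpace F] {f : E × F → ℂ}
    {U D : Set E} {W : Set F} (hU : IsOpen U) (hUc : IsPreconnected U) (hW : IsOpen W)
    (hD : IsOpen D) (hDne : D.Nonempty) (hDU : D ⊆ U) (hf : DifferentiableOn ℂ f (D ×ˢ W))
    (hslice : ∀ w ∈ W, DifferentiableOn ℂ (fun z => f (z, w)) U) :
    DifferentiableOn ℂ f (U ×ˢ W) := by
  let Ω : Set E := {z | ∃ ε > 0, DifferentiableOn ℂ f (ball z ε ×ˢ W)}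
  have hΩ : IsOpen Ω := by
    refine Metric.isOpen_iff.2 ?_
    rintro z ⟨ε, hε, hd⟩
    refine ⟨ε / 2, by positivity, fun y hy => ⟨ε / 2, by positivity, hd.mono ?_⟩⟩
    refine prod_mono_left (ball_subset_ball' ?_)
    linarith [mem_ball.1 hy]
  have hsub : U ⊆ Ω := by
    refine hUc.subset_of_closure_inter_subset hΩ ?_ ?_
    · obtain ⟨z, hz⟩ := hDne
      obtain ⟨ε, hε, hεD⟩ := Metric.isOpen_iff.1 hD z hz
      exact ⟨z, hDU hz, ε, hε, hf.mono (prod_mono_left hεD)⟩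
    · rintro z ⟨hzcl, hzU⟩
      obtain ⟨ε, hε, hεU⟩ := Metric.isOpen_iff.1 hU z hzU
      obtain ⟨y, ⟨η, hη, hd⟩, hzy⟩ := Metric.mem_closure_iff.1 hzcl (ε / 3) (by positivity)
      have hyU : ball y (2 * ε / 3) ⊆ U := by
        refine (ball_subset_ball' ?_).trans hεU
        rw [dist_comm]
        linarith
      refine ⟨ε / 3, by positivity, (differentiableOn_ball_prod_of_slices hη hW hd
        fun w hw => (hslice w hw).mono hyU).mono (prod_mono_left (ball_subset_ball' ?_))⟩
      linarith
  rintro ⟨z, w⟩ ⟨hz, hw⟩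
  obtain ⟨ε, hε, hd⟩ := hsub hz
  exact (hd.differentiableAt ((isOpen_ball.prod hW).mem_nhds
    ⟨mem_ball_self hε, hw⟩)).differentiableWithinAt

/-- A separately holomorphic function is jointly holomorphic on some nonempty open product. -/
theorem exists_differentiableOn_prod_of_separately [ProperSpace E] [CompleteSpace F]
    {f : E × F → ℂ} {V : Set E} {G : Set F} (hV : IsOpen V) (hVne : V.Nonempty) (hG : IsOpen G)
    (hGne : G.Nonempty) (h1 : ∀ w ∈ G, DifferentiableOn ℂ (fun z => f (z, w)) V)
    (h2 : ∀ z ∈ V, DifferentiableOn ℂ (fun w => f (z, w)) G) :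
    ∃ D W, IsOpen D ∧ D.Nonempty ∧ D ⊆ V ∧ IsOpen W ∧ W.Nonempty ∧ W ⊆ G ∧
      DifferentiableOn ℂ f (D ×ˢ W) := by
  obtain ⟨z₀, hz₀⟩ := hVne
  obtain ⟨ε, hε, hεV⟩ := nhds_basis_closedBall.mem_iff.1 (hV.mem_nhds hz₀)
  have : BaireSpace G := hG.baireSpace
  have : Nonempty G := hGne.to_subtype
  let A : ℕ → Set G := fun k => {w | ∀ z ∈ closedBall z₀ ε, ‖f (z, w)‖ ≤ k}
  have hA : ∀ k, IsClosed (A k) := fun k => by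
    simp only [A, ofPred_forall]
    refine isClosed_biInter fun z hz => isClosed_le ?_ continuous_const
    exact (continuousOn_iff_continuous_domRestrict.1 (h2 z (hεV hz)).continuousOn).norm
  have hAU : ⋃ k, A k = univ := by
    refine eq_univ_of_forall fun w => mem_iUnion.2 ?_
    obtain ⟨C, hC⟩ := (isCompact_closedBall z₀ ε).exists_bound_of_continuousOn
      ((h1 w w.2).continuousOn.mono hεV)
    obtain ⟨k, hk⟩ := exists_nat_ge C
    exact ⟨k, fun z hz => (hC z hz).trans hk⟩
  obtain ⟨k, hk⟩ := nonempty_interior_of_iUnion_of_closed hA hAU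
  have hWG : (↑) '' interior (A k) ⊆ G := by
    rintro _ ⟨w, -, rfl⟩
    exact w.2
  have hWo : IsOpen ((↑) '' interior (A k) : Set F) :=
    hG.isOpenMap_subtype_val _ isOpen_interior
  have hDV : ball z₀ ε ⊆ V := ball_subset_closedBall.trans hεV
  refine ⟨ball z₀ ε, (↑) '' interior (A k), isOpen_ball, ⟨z₀, mem_ball_self hε⟩, hDV, hWo,
    hk.image _, hWG, differentiableOn_prod_of_bounded (M := k) isOpen_ball hWo
      (fun w hw => (h1 w (hWG hw)).mono hDV)
      (fun z hz => (h2 z (hDV hz)).mono hWG) ?_⟩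
  rintro z hz _ ⟨w, hw, rfl⟩
  exact interior_subset hw z (ball_subset_closedBall hz)

/-- The holomorphic extension theorem for the cross `V × G ∪ U × G`. -/
theorem differentiableOn_prod_of_separately [ProperSpace E] [ProperSpace F] {f : E × F → ℂ}
    {U V : Set E} {G : Set F} (hU : IsOpen U) (hUc : IsPreconnected U) (hG : IsOpen G)
    (hGc : IsPreconnected G) (hGne : G.Nonempty) (hV : IsOpen V) (hVne : V.Nonempty) (hVU : V ⊆ U)
    (h1 : ∀ w ∈ G, DifferentiableOn ℂ (fun z => f (z, w)) U)
    (h2 : ∀ z ∈ V, DifferentiableOn ℂ (fun w => f (z, w)) G) :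
    DifferentiableOn ℂ f (U ×ˢ G) := by
  obtain ⟨D, W, hD, hDne, hDV, hW, hWne, hWG, hDW⟩ :=
    exists_differentiableOn_prod_of_separately hV hVne hG hGne
      (fun w hw => (h1 w hw).mono hVU) h2
  have hGD := differentiableOn_prod_of_isPreconnected (f := fun v : F × E => f v.swap) hG hGc hD
    hW hWne hWG (hDW.comp (f := Prod.swap) (by unfold Prod.swap; fun_prop) fun v hv => hv.symm)
    (fun z hz => h2 z (hDV hz))
  have hDG : DifferentiableOn ℂ f (D ×ˢ G) :=
    hGD.comp (f := Prod.swap) (by unfold Prod.swap; fun_prop) fun v hv => hv.symm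
  exact differentiableOn_prod_of_isPreconnected hU hUc hG hD hDne (hDV.trans hVU) hDG h1

end Extension

/-- Terada-type theorem: if `f : U × G → ℂ` is holomorphic in the first variable for every
`w ∈ G` and holomorphic in the second variable for every `z` in a nonempty open subset
`V ⊆ U`, then `f` is holomorphic on `U × G` (with `U`, `G` nonempty open connected). -/
theorem terada_type_theorem (m ν : ℕ) (U V : Set (Fin m → ℂ)) (G : Set (Fin ν → ℂ))
    (hUne : U.Nonempty) (hUo : IsOpen U) (hUc : IsConnected U)
    (hGne : G.Nonempty) (hGo : IsOpen G) (hGc : IsConnected G)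
    (hVne : V.Nonempty) (hVo : IsOpen V) (hVU : V ⊆ U)
    (f : (Fin m → ℂ) × (Fin ν → ℂ) → ℂ)
    (hf1 : ∀ w ∈ G, DifferentiableOn ℂ (fun z : Fin m → ℂ => f (z, w)) U)
    (hf2 : ∀ z ∈ V, DifferentiableOn ℂ (fun w : Fin ν → ℂ => f (z, w)) G) :
    DifferentiableOn ℂ f (U ×ˢ G) :=
  differentiableOn_prod_of_separately hUo hUc.isPreconnected hGo hGc.isPreconnected hGne hVo hVne
    hVU hf1 hf2
end

section
/- Let N ≥ 2 and 1 ≤ k ≤ N be integers. For j = 1,…,N let D_j be a nonempty connected topological space and A_j ⊆ D_j a nonempty subset. Then the (N,k)-cross X_{N,k}, regarded as a subset of the product space D_1 × ⋯ × D_N, is connected. -/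
/-- The `k`-cross of a family of subsets `A j ⊆ D j`: the points having all coordinates in
`A j` except possibly those indexed by some `k`-element set. -/
def crossSet {ι : Type*} {D : ι → Type*} (A : ∀ j, Set (D j)) (k : ℕ) : Set (∀ j, D j) :=
  {z | ∃ S : Finset ι, S.card = k ∧ ∀ j ∉ S, z j ∈ A j}

section

variable {ι : Type*} {D : ι → Type*} [∀ j, TopologicalSpace (D j)] {A : ∀ j, Set (D j)} {k : ℕ}

theorem mem_connectedComponentIn_crossSet_of_eqOn [∀ j, PreconnectedSpace (D j)]
    {S : Finset ι} (hS : S.card = k) {w z : ∀ j, D j} (hw : ∀ j ∉ S, w j ∈ A j)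
    (h : ∀ j ∉ S, z j = w j) : z ∈ connectedComponentIn (crossSet A k) w := by
  classical
  have hpre : IsPreconnected (Set.univ.pi fun j => if j ∈ S then Set.univ else {w j}) := by
    refine isPreconnected_univ_pi fun j => ?_
    split_ifs
    · exact isPreconnected_univ
    · exact isPreconnected_singleton
  refine hpre.subset_connectedComponentIn ?_ ?_ ?_
  · intro j _
    dsimp only
    split_ifs <;> simp
  · intro y hy
    refine ⟨S, hS, fun j hj => ?_⟩
    have hyj := hy j trivial
    simp only [if_neg hj, Set.mem_singleton_iff] at hyj
    exact hyj ▸ hw j hj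
  · intro j _
    dsimp only
    split_ifs with hj
    · trivial
    · exact h j hj

theorem isConnected_crossSet [Finite ι] [∀ j, PreconnectedSpace (D j)] (hk : 1 ≤ k)
    (hkι : k ≤ Nat.card ι) (hA : ∀ j, (A j).Nonempty) : IsConnected (crossSet A k) := by
  classical
  have := Fintype.ofFinite ι
  rw [Nat.card_eq_fintype_card] at hkι
  choose a ha using hA
  have piecewise_mem (w : ∀ j, D j) (hw : ∀ j, w j ∈ A j) (T : Finset ι) :
      T.piecewise w a ∈ connectedComponentIn (crossSet A k) a := by
    induction T using Finset.induction_on with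
    | empty =>
      obtain ⟨S, -, hS⟩ := Finset.exists_subset_card_eq (s := Finset.univ) hkι
      rw [Finset.piecewise_empty]
      exact mem_connectedComponentIn ⟨S, hS, fun j _ => ha j⟩
    | insert i T _ ih =>
      obtain ⟨S, hiS, -, hS⟩ := Finset.exists_subsuperset_card_eq
        (Finset.subset_univ {i}) (by simpa using hk) hkι
      rw [connectedComponentIn_eq ih, Finset.piecewise_insert]
      refine mem_connectedComponentIn_crossSet_of_eqOn hS (fun j _ => ?_) fun j hj => ?_
      · exact Finset.piecewise_cases T w a (· ∈ A j) (hw j) (ha j)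
      · exact Function.update_of_ne (fun h : j = i => hj (h ▸ hiS (Finset.mem_singleton_self i))) _ _
  have hsub : crossSet A k ⊆ connectedComponentIn (crossSet A k) a := by
    rintro z ⟨S, hS, hz⟩
    have hw (j : ι) : S.piecewise a z j ∈ A j := by
      by_cases hj : j ∈ S
      · simpa [hj] using ha j
      · simpa [hj] using hz j hj
    have hmem := piecewise_mem _ hw Finset.univ
    rw [Finset.piecewise_univ] at hmem
    rw [connectedComponentIn_eq hmem]
    exact mem_connectedComponentIn_crossSet_of_eqOn hS (fun j _ => hw j)
      fun j hj => (Finset.piecewise_eq_of_notMem S a z hj).symm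
  obtain ⟨S, -, hS⟩ := Finset.exists_subset_card_eq (s := Finset.univ) hkι
  refine ⟨⟨a, S, hS, fun j _ => ha j⟩, ?_⟩
  rw [hsub.antisymm (connectedComponentIn_subset _ _)]
  exact isPreconnected_connectedComponentIn

end


/-- The `(N,k)`-cross formed from pairs `(A_j, D_j)`, where each `D_j` is a nonempty
connected topological space and `A_j ⊆ D_j` is nonempty, is a connected subset of the
product space `D_1 × ⋯ × D_N`. -/
theorem cross_Nk_isConnected (N : ℕ) (hN : 2 ≤ N) (k : ℕ) (hk1 : 1 ≤ k) (hkN : k ≤ N)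
    (D : Fin N → Type*) [∀ j, TopologicalSpace (D j)] [∀ j, ConnectedSpace (D j)]
    (A : ∀ j, Set (D j)) (hAne : ∀ j, (A j).Nonempty) :
    IsConnected
      {z : ∀ j, D j | ∃ S : Finset (Fin N), S.card = k ∧ ∀ j ∉ S, z j ∈ A j} := by
  exact isConnected_crossSet hk1 (by simpa using hkN) hAne
end

section
/- Let N ≥ 2 and 2 ≤ k ≤ N be integers, and let t_1,…,t_N be real numbers with 0 < t_j < 1 for every j. Set T := t_1 + ⋯ + t_N and assume k − 1 < T < k. Then there exist real numbers s_1,…,s_N ∈ (0,1] such that s_1 + ⋯ + s_N = k and t_j < s_j < t_j/(T − k + 1) for every j = 1,…,N. -/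
/-- If `k < N` and `θ = ∑ t_j - k + 1` lies in `(0,1)`, the truncations `min 1 (t_j / θ)` of the
rescaled numbers have total strictly greater than `k`. -/
theorem lt_sum_min_one_div {N k : ℕ} (hk2 : 2 ≤ k) (hkN : k < N) {t : Fin N → ℝ}
    (ht : ∀ j, 0 < t j ∧ t j < 1) {θ : ℝ} (hθ : θ = ∑ j, t j - k + 1) (h0 : 0 < θ)
    (h1 : θ < 1) : (k : ℝ) < ∑ j, min 1 (t j / θ) := by
  classical
  set A := Finset.univ.filter fun j => θ ≤ t j with hA
  have hsplit : ∑ j, min 1 (t j / θ) = ∑ j ∈ A, min 1 (t j / θ) + ∑ j ∈ Aᶜ, min 1 (t j / θ) :=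
    (Finset.sum_add_sum_compl A _).symm
  have hin : ∑ j ∈ A, min 1 (t j / θ) = (A.card : ℝ) := by
    rw [Finset.sum_congr rfl fun j hj => min_eq_left ((one_le_div h0).2 (by simpa [hA] using hj))]
    simp
  have hout : ∑ j ∈ Aᶜ, min 1 (t j / θ) = (∑ j ∈ Aᶜ, t j) / θ := by
    rw [Finset.sum_div]
    refine Finset.sum_congr rfl fun j hj => min_eq_right ((div_le_one h0).2 ?_)
    have hlt : t j < θ := by simpa [hA] using hj
    exact hlt.le
  have hsum : ∑ j, t j = ∑ j ∈ A, t j + ∑ j ∈ Aᶜ, t j := (Finset.sum_add_sum_compl A _).symm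
  rw [hsplit, hin, hout]
  rcases lt_trichotomy A.card k with hlt | heq | hgt
  · have hcard : (A.card : ℝ) + 1 ≤ k := by exact_mod_cast hlt
    have hk : (2 : ℝ) ≤ k := by exact_mod_cast hk2
    suffices (k - A.card : ℝ) < (∑ j ∈ Aᶜ, t j) / θ by linarith
    rw [lt_div_iff₀ h0]
    rcases A.eq_empty_or_nonempty with hempty | hne
    · have hc : (A.card : ℝ) = 0 := by simp [hempty]
      have hs : ∑ j ∈ A, t j = 0 := by simp [hempty]
      rw [hc]
      nlinarith
    · have hs : ∑ j ∈ A, t j < A.card := by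
        simpa using Finset.sum_lt_sum_of_nonempty hne fun j _ => (ht j).2
      nlinarith [mul_nonneg (sub_nonneg.2 h1.le) (sub_nonneg.2 hcard)]
  · have hne : Aᶜ.Nonempty := by
      rw [← Finset.card_pos, Finset.card_compl, Fintype.card_fin]
      omega
    have hpos : 0 < (∑ j ∈ Aᶜ, t j) / θ := div_pos (Finset.sum_pos (fun j _ => (ht j).1) hne) h0
    rw [heq]
    linarith
  · have hnonneg : 0 ≤ (∑ j ∈ Aᶜ, t j) / θ :=
      div_nonneg (Finset.sum_nonneg fun j _ => (ht j).1.le) h0.le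
    have hgt' : (k : ℝ) < A.card := by exact_mod_cast hgt
    linarith


/-- Numerical selection lemma: if `0 < t_j < 1`, `T = t_1 + ⋯ + t_N`, and
`k - 1 < T < k`, then there are `s_j ∈ (0,1]` with `s_1 + ⋯ + s_N = k` and
`t_j < s_j < t_j / (T - k + 1)` for every `j`. -/
theorem selection_lemma (N : ℕ) (hN : 2 ≤ N) (k : ℕ) (hk2 : 2 ≤ k) (hkN : k ≤ N)
    (t : Fin N → ℝ) (ht : ∀ j, 0 < t j ∧ t j < 1)
    (T : ℝ) (hT : T = ∑ j, t j) (hT1 : (k : ℝ) - 1 < T) (hT2 : T < k) :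
    ∃ s : Fin N → ℝ, (∀ j, 0 < s j ∧ s j ≤ 1) ∧ (∑ j, s j) = k ∧
      ∀ j, t j < s j ∧ s j < t j / (T - k + 1) := by
  have h0 : 0 < T - k + 1 := by linarith
  have h1 : T - k + 1 < 1 := by linarith
  rcases hkN.eq_or_lt with rfl | hlt
  · refine ⟨fun _ => 1, fun _ => ⟨one_pos, le_rfl⟩, by simp, fun j => ⟨(ht j).2, ?_⟩⟩
    rw [one_lt_div h0]
    have hne : (Finset.univ.erase j).Nonempty := by
      rw [← Finset.card_pos, Finset.card_erase_of_mem (Finset.mem_univ j), Finset.card_univ,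
        Fintype.card_fin]
      omega
    have hs := Finset.sum_lt_sum_of_nonempty hne fun i _ => (ht i).2
    have hone := Finset.sum_erase_add Finset.univ (fun _ : Fin k => (1 : ℝ)) (Finset.mem_univ j)
    have hsplit := Finset.sum_erase_add Finset.univ t (Finset.mem_univ j)
    have hcard : ∑ _i : Fin k, (1 : ℝ) = k := by simp
    linarith
  · have hU := lt_sum_min_one_div hk2 hlt ht (by rw [hT]) h0 h1
    set u : Fin N → ℝ := fun j => min 1 (t j / (T - k + 1)) with hu
    have htu : ∀ j, t j < u j := fun j =>
      lt_min (ht j).2 ((lt_div_iff₀ h0).2 (by nlinarith [(ht j).1]))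
    have hden : 0 < ∑ j, u j - T := by linarith
    set c := (k - T) / (∑ j, u j - T) with hc
    have hc0 : 0 < c := div_pos (by linarith) hden
    have hc1 : c < 1 := (div_lt_one hden).2 (by linarith)
    have hlo : ∀ j, t j < t j + c * (u j - t j) := fun j => by
      linarith [mul_pos hc0 (sub_pos.2 (htu j))]
    have hhi : ∀ j, t j + c * (u j - t j) < u j := fun j => by
      linarith [mul_pos (sub_pos.2 hc1) (sub_pos.2 (htu j))]
    refine ⟨fun j => t j + c * (u j - t j), fun j => ⟨(ht j).1.trans (hlo j),
      (hhi j).le.trans (min_le_left _ _)⟩, ?_, fun j => ⟨hlo j, (hhi j).trans_le (min_le_right _ _)⟩⟩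
    rw [Finset.sum_add_distrib, ← Finset.mul_sum, Finset.sum_sub_distrib, ← hT, hc,
      div_mul_cancel₀ _ hden.ne']
    ring
end
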